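/- Fix n ≥ 1, h > 0, parameters μ_i, K_i ∈ ℝ and σ_i > 0 for i = 1,…,n, covariates z₁,…,z_n, and threshold functions δ(β, z_i) that are twice continuously differentiable in β ∈ ℝ with derivatives δ'(β, z_i), δ''(β, z_i). Let W(β) = (1/n) Σ_i (μ_i − K_i) Φ((μ_i − δ(β, z_i))/σ_i) and Ŵ_h(β) = (1/n) Σ_i Ψ_h^{(i)}(Y_i; β) with Y_i independent, Y_i ~ N(μ_i, σ_i²). Then there is a universal constant c > 0 such that |W'(β) − E[Ŵ_h'(β)]| ≤ c · ( (1/n) Σ_i (|μ_i − K_i|/σ_i) |δ'(β, z_i)| ) · h · e^{−1/(2h²)}, and |W''(β) − E[Ŵ_h''(β)]| ≤ c · [ h · (1/n) Σ_i (|μ_i − K_i|/σ_i) |δ''(β, z_i)| + (1/n) Σ_i (|μ_i − K_i|/σ_i²) δ'(β, z_i)² ] · e^{−1/(2h²)}. -/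

import Mathlib

open MeasureTheory ProbabilityTheory

/-- standard normal density -/
noncomputable def phiR (x : ℝ) : ℝ := (Real.sqrt (2 * Real.pi))⁻¹ * Real.exp (-(x ^ 2) / 2)

/-- standard normal CDF -/
noncomputable def PhiR (x : ℝ) : ℝ := ∫ t in Set.Iic x, phiR t

/-- sinc kernel, normalized by π -/
noncomputable def sincR (x : ℝ) : ℝ := if x = 0 then 1 / Real.pi else Real.sin x / (Real.pi * x)

/-- sine integral -/
noncomputable def SiR (x : ℝ) : ℝ := ∫ t in (0:ℝ)..x, Real.sin t / t

/-- cumulative sinc -/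
noncomputable def CsincR (x : ℝ) : ℝ := 1 / 2 + SiR x / Real.pi

/-- the ASSURE summand for unit `i`, as a function of the tuning parameter `β` -/
noncomputable def assureSummand (K σ h : ℝ) (δi : ℝ → ℝ) (y β : ℝ) : ℝ :=
  (y - K) * CsincR ((y - δi β) / (σ * h)) - (σ / h) * sincR ((y - δi β) / (σ * h))

lemma aux_cos_param (p : ℝ → ℝ) (hp : Continuous p) (u : ℝ) :
    HasDerivAt (fun u => ∫ t in (0:ℝ)..1, p t * Real.cos (u * t))
      (∫ t in (0:ℝ)..1, -(p t * t * Real.sin (u * t))) u := by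
  refine (intervalIntegral.hasDerivAt_integral_of_dominated_loc_of_deriv_le
    (F := fun u t => p t * Real.cos (u * t)) (F' := fun u t => -(p t * t * Real.sin (u * t)))
    (bound := fun t => |p t * t|) (s := Set.univ) Filter.univ_mem ?_ ?_ ?_ ?_ ?_ ?_).2
  · exact Filter.Eventually.of_forall fun x => (by fun_prop : Continuous _).aestronglyMeasurable
  · exact (by fun_prop : Continuous _).intervalIntegrable _ _
  · exact (by fun_prop : Continuous _).aestronglyMeasurable
  · refine Filter.Eventually.of_forall fun t _ x _ => ?_
    rw [norm_neg, norm_mul, Real.norm_eq_abs, Real.norm_eq_abs]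
    exact mul_le_of_le_one_right (abs_nonneg _) (Real.abs_sin_le_one _)
  · exact (by fun_prop : Continuous _).intervalIntegrable _ _
  · refine Filter.Eventually.of_forall fun t _ x _ => ?_
    have := (((hasDerivAt_id x).mul_const t).cos).const_mul (p t)
    exact this.congr_deriv (by simp; ring)

lemma aux_sin_param (p : ℝ → ℝ) (hp : Continuous p) (u : ℝ) :
    HasDerivAt (fun u => ∫ t in (0:ℝ)..1, p t * Real.sin (u * t))
      (∫ t in (0:ℝ)..1, (p t * t * Real.cos (u * t))) u := by
  refine (intervalIntegral.hasDerivAt_integral_of_dominated_loc_of_deriv_le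
    (F := fun u t => p t * Real.sin (u * t)) (F' := fun u t => (p t * t * Real.cos (u * t)))
    (bound := fun t => |p t * t|) (s := Set.univ) Filter.univ_mem ?_ ?_ ?_ ?_ ?_ ?_).2
  · exact Filter.Eventually.of_forall fun x => (by fun_prop : Continuous _).aestronglyMeasurable
  · exact (by fun_prop : Continuous _).intervalIntegrable _ _
  · exact (by fun_prop : Continuous _).aestronglyMeasurable
  · refine Filter.Eventually.of_forall fun t _ x _ => ?_
    rw [norm_mul, Real.norm_eq_abs, Real.norm_eq_abs]
    exact mul_le_of_le_one_right (abs_nonneg _) (Real.abs_cos_le_one _)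
  · exact (by fun_prop : Continuous _).intervalIntegrable _ _
  · refine Filter.Eventually.of_forall fun t _ x _ => ?_
    have := (((hasDerivAt_id x).mul_const t).sin).const_mul (p t)
    exact this.congr_deriv (by simp; ring)

noncomputable def S1 (u : ℝ) : ℝ := -(Real.pi⁻¹ * ∫ t in (0:ℝ)..1, t * Real.sin (u * t))
noncomputable def S2 (u : ℝ) : ℝ := -(Real.pi⁻¹ * ∫ t in (0:ℝ)..1, t * t * Real.cos (u * t))

lemma sincR_eq (u : ℝ) : sincR u = Real.pi⁻¹ * ∫ t in (0:ℝ)..1, 1 * Real.cos (u * t) := by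
  unfold sincR
  split_ifs with h
  · subst h; simp
  · simp only [one_mul]
    rw [intervalIntegral.integral_comp_mul_left (fun x => Real.cos x) h]
    simp
    field_simp

lemma sincR_hasDeriv (u : ℝ) : HasDerivAt sincR (S1 u) u := by
  have h := (aux_cos_param (fun _ => 1) continuous_const u).const_mul (Real.pi⁻¹)
  have e : sincR = fun u => Real.pi⁻¹ * ∫ t in (0:ℝ)..1, 1 * Real.cos (u * t) := funext sincR_eq
  rw [e]
  exact h.congr_deriv (by simp [S1])

lemma S1_hasDeriv (u : ℝ) : HasDerivAt S1 (S2 u) u := by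
  have h := ((aux_sin_param (fun t => t) continuous_id u).const_mul (Real.pi⁻¹)).neg
  exact h

lemma S2_cont : Continuous S2 := by
  have h : Continuous (fun u => ∫ t in (0:ℝ)..1, t * t * Real.cos (u * t)) :=
    continuous_iff_continuousAt.2 fun u =>
      (aux_cos_param (fun t => t * t) (by fun_prop) u).continuousAt
  unfold S2
  fun_prop

lemma aux_bound (f : ℝ → ℝ) (hf : ∀ t ∈ Set.Icc (0:ℝ) 1, |f t| ≤ 1) :
    |Real.pi⁻¹ * ∫ t in (0:ℝ)..1, f t| ≤ 1 := by
  have h : ‖∫ t in (0:ℝ)..1, f t‖ ≤ 1 * |1 - 0| :=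
    intervalIntegral.norm_integral_le_of_norm_le_const fun t ht => by
      rw [Set.uIoc_of_le zero_le_one] at ht
      exact hf t ⟨ht.1.le, ht.2⟩
  rw [Real.norm_eq_abs] at h
  have hp : Real.pi⁻¹ ≤ 1 := inv_le_one_of_one_le₀ (by linarith [Real.pi_gt_three])
  rw [abs_mul, abs_of_pos (by positivity : 0 < Real.pi⁻¹)]
  have : |(1:ℝ) - 0| = 1 := by norm_num
  rw [this] at h
  have h0 : 0 < Real.pi⁻¹ := by positivity
  nlinarith [abs_nonneg (∫ t in (0:ℝ)..1, f t)]

lemma sincR_bound (u : ℝ) : |sincR u| ≤ 1 := by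
  rw [sincR_eq]
  exact aux_bound _ fun t ht => by rw [one_mul]; exact Real.abs_cos_le_one _

lemma S1_bound (u : ℝ) : |S1 u| ≤ 1 := by
  rw [S1, abs_neg]
  refine aux_bound _ fun t ht => ?_
  rw [abs_mul, abs_of_nonneg ht.1]
  nlinarith [Real.abs_sin_le_one (u * t), abs_nonneg (Real.sin (u * t)), ht.1, ht.2]

lemma S2_bound (u : ℝ) : |S2 u| ≤ 1 := by
  rw [S2, abs_neg]
  refine aux_bound _ fun t ht => ?_
  rw [abs_mul, abs_of_nonneg (by nlinarith [ht.1])]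
  have : t * t ≤ 1 := by nlinarith [ht.1, ht.2]
  have h0 : 0 ≤ t * t := mul_self_nonneg t
  nlinarith [Real.abs_cos_le_one (u * t), abs_nonneg (Real.cos (u * t))]

lemma sincR_cont : Continuous sincR :=
  continuous_iff_continuousAt.2 fun u => (sincR_hasDeriv u).continuousAt

lemma S1_cont : Continuous S1 :=
  continuous_iff_continuousAt.2 fun u => (S1_hasDeriv u).continuousAt

lemma CsincR_hasDeriv (u : ℝ) : HasDerivAt CsincR (sincR u) u := by
  have e : SiR = fun x => ∫ t in (0:ℝ)..x, Real.pi * sincR t := by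
    funext x
    unfold SiR
    refine intervalIntegral.integral_congr_ae ?_
    have : ∀ᵐ t : ℝ, t ≠ 0 := by simp [ae_iff]
    filter_upwards [this] with t ht _
    simp only [sincR, ht, if_false]
    field_simp
  have h : HasDerivAt SiR (Real.pi * sincR u) u := by
    rw [e]
    have hc : Continuous fun t => Real.pi * sincR t := continuous_const.mul sincR_cont
    exact intervalIntegral.integral_hasDerivAt_right (hc.intervalIntegrable _ _)
      (hc.stronglyMeasurableAtFilter _ _) hc.continuousAt
  have h2 := (h.div_const Real.pi).const_add (1/2)
  exact h2.congr_deriv (by field_simp)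

lemma phiR_cont : Continuous phiR := by unfold phiR; fun_prop

lemma phiR_hasDeriv (x : ℝ) : HasDerivAt phiR (-(x * phiR x)) x := by
  unfold phiR
  have := (((hasDerivAt_pow 2 x).neg.div_const 2).exp).const_mul ((Real.sqrt (2 * Real.pi))⁻¹)
  exact this.congr_deriv (by simp; ring)

lemma exp_integrable : Integrable (fun x : ℝ => Real.exp (-(x ^ 2) / 2)) := by
  have := integrable_exp_neg_mul_sq (b := 1/2) (by norm_num)
  convert this using 3
  ring

lemma xexp_integrable : Integrable (fun x : ℝ => x * Real.exp (-(x ^ 2) / 2)) := by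
  have := integrable_mul_exp_neg_mul_sq (b := 1/2) (by norm_num)
  convert this using 4
  ring

lemma phiR_integrable : Integrable phiR := exp_integrable.const_mul _

lemma xphiR_integrable : Integrable (fun x => x * phiR x) := by
  have := xexp_integrable.const_mul ((Real.sqrt (2 * Real.pi))⁻¹)
  convert this using 2
  unfold phiR; ring

lemma PhiR_hasDeriv (x : ℝ) : HasDerivAt PhiR (phiR x) x := by
  have e : PhiR = fun x => (∫ t in Set.Iic 0, phiR t) + ∫ t in (0:ℝ)..x, phiR t := by
    funext x
    rw [← intervalIntegral.integral_Iic_sub_Iic phiR_integrable.integrableOn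
      phiR_integrable.integrableOn]
    unfold PhiR; ring
  rw [e]
  exact (intervalIntegral.integral_hasDerivAt_right (phiR_cont.intervalIntegrable _ _)
      (phiR_cont.stronglyMeasurableAtFilter _ _) phiR_cont.continuousAt).const_add _

lemma gauss_int (f : ℝ → ℝ) : ∫ x, f x ∂(gaussianReal 0 1) = ∫ x, phiR x * f x := by
  rw [integral_gaussianReal_eq_integral_smul one_ne_zero]
  congr 1; funext x
  simp [gaussianPDFReal, phiR]

lemma stein (f f' : ℝ → ℝ) (hf : ∀ x, HasDerivAt f (f' x) x) (hc : Continuous f')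
    (B : ℝ) (hb : ∀ x, |f x| ≤ B) (hb' : ∀ x, |f' x| ≤ B) :
    ∫ x, x * f x ∂(gaussianReal 0 1) = ∫ x, f' x ∂(gaussianReal 0 1) := by
  have hfc : Continuous f := continuous_iff_continuousAt.2 fun u => (hf u).continuousAt
  rw [gauss_int, gauss_int]
  have := integral_mul_deriv_eq_deriv_mul_of_integrable (u := f) (v := phiR) (u' := f')
    (v' := fun x => -(x * phiR x)) (fun x _ => hf x) (fun x _ => phiR_hasDeriv x)
    (xphiR_integrable.neg.bdd_mul hfc.aestronglyMeasurable (Filter.Eventually.of_forall hb))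
    (phiR_integrable.bdd_mul hc.aestronglyMeasurable (Filter.Eventually.of_forall hb'))
    (phiR_integrable.bdd_mul hfc.aestronglyMeasurable (Filter.Eventually.of_forall hb))
  have e1 : ∀ x, phiR x * (x * f x) = -(f x * -(x * phiR x)) := fun x => by ring
  have e2 : ∀ x, phiR x * f' x = f' x * phiR x := fun x => by ring
  simp_rw [e1, e2]
  rw [integral_neg, this, neg_neg]

lemma gauss_cexp (t a : ℝ) :
    ∫ x : ℝ, Complex.exp ((t * x + a : ℝ) * Complex.I) ∂(gaussianReal 0 1)
      = Complex.exp (a * Complex.I) * (Real.exp (-(t ^ 2) / 2) : ℝ) := by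
  have h := charFun_gaussianReal (μ := 0) (v := 1) t
  rw [charFun_apply_real] at h
  have e : ∀ x : ℝ, Complex.exp ((t * x + a : ℝ) * Complex.I)
      = Complex.exp (a * Complex.I) * Complex.exp (t * x * Complex.I) := fun x => by
    rw [← Complex.exp_add]; push_cast; ring_nf
  simp_rw [e]
  rw [integral_const_mul, h]
  push_cast
  congr 2
  simp; ring

lemma gauss_cexp_int (t a : ℝ) :
    Integrable (fun x : ℝ => Complex.exp ((t * x + a : ℝ) * Complex.I)) (gaussianReal 0 1) := by
  refine Integrable.of_bound (by fun_prop : Continuous _).aestronglyMeasurable 1 ?_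
  exact Filter.Eventually.of_forall fun x => (Complex.norm_exp_ofReal_mul_I _).le

lemma gauss_cos (t a : ℝ) :
    ∫ x : ℝ, Real.cos (t * x + a) ∂(gaussianReal 0 1) = Real.cos a * Real.exp (-(t ^ 2) / 2) := by
  have h := congrArg Complex.re (gauss_cexp t a)
  have h2 := integral_re (gauss_cexp_int t a)
  simp only [RCLike.re_eq_complex_re] at h2
  rw [← h2, Complex.re_mul_ofReal] at h
  simpa only [Complex.exp_ofReal_mul_I_re] using h

lemma gauss_sin (t a : ℝ) :
    ∫ x : ℝ, Real.sin (t * x + a) ∂(gaussianReal 0 1) = Real.sin a * Real.exp (-(t ^ 2) / 2) := by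
  have h := congrArg Complex.im (gauss_cexp t a)
  have h2 := integral_im (gauss_cexp_int t a)
  simp only [RCLike.im_eq_complex_im] at h2
  rw [← h2, Complex.im_mul_ofReal] at h
  simpa only [Complex.exp_ofReal_mul_I_im] using h

lemma fub (p : ℝ → ℝ) (hp : Continuous p) (g : ℝ → ℝ) (hg : Continuous g) (hb : ∀ x, |g x| ≤ 1)
    (m h : ℝ) :
    ∫ x, (∫ t in (0:ℝ)..1, p t * g ((x + m) / h * t)) ∂(gaussianReal 0 1)
      = ∫ t in (0:ℝ)..1, p t * ∫ x, g (t / h * x + m * (t / h)) ∂(gaussianReal 0 1) := by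
  have hi : Integrable (Function.uncurry fun x t => p t * g ((x + m) / h * t))
      ((gaussianReal 0 1).prod (volume.restrict (Set.uIoc (0:ℝ) 1))) := by
    have h1 : Integrable p (volume.restrict (Set.uIoc (0:ℝ) 1)) :=
      intervalIntegrable_iff.1 (hp.intervalIntegrable 0 1)
    refine (h1.comp_snd (gaussianReal 0 1)).mono
      (by unfold Function.uncurry; fun_prop : Continuous _).aestronglyMeasurable ?_
    refine Filter.Eventually.of_forall fun x => ?_
    simp only [Function.uncurry, norm_mul]
    exact mul_le_of_le_one_right (norm_nonneg _) (hb _)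
  have := integral_integral_swap hi
  simp_rw [intervalIntegral.integral_of_le (zero_le_one (α := ℝ))]
  rw [Set.uIoc_of_le zero_le_one] at this
  rw [this]
  congr 1; funext t
  rw [integral_const_mul]
  congr 2; funext x; congr 1; ring

lemma E_sinc (m h : ℝ) (hh : 0 < h) :
    ∫ x, sincR ((x + m) / h) ∂(gaussianReal 0 1)
      = h * Real.pi⁻¹ * ∫ s in (0:ℝ)..(1 / h), Real.cos (m * s) * Real.exp (-(s ^ 2) / 2) := by
  simp_rw [sincR_eq]
  rw [integral_const_mul, fub (fun _ => 1) continuous_const _ Real.continuous_cos Real.abs_cos_le_one]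
  simp_rw [gauss_cos, one_mul]
  rw [intervalIntegral.integral_comp_div
    (fun s => Real.cos (m * s) * Real.exp (-(s ^ 2) / 2)) hh.ne']
  simp; ring

lemma E_S1 (m h : ℝ) (hh : 0 < h) :
    ∫ x, S1 ((x + m) / h) ∂(gaussianReal 0 1)
      = -(h ^ 2 * Real.pi⁻¹ *
        ∫ s in (0:ℝ)..(1 / h), s * (Real.sin (m * s) * Real.exp (-(s ^ 2) / 2))) := by
  simp_rw [S1]
  rw [integral_neg, integral_const_mul,
    fub (fun t => t) continuous_id _ Real.continuous_sin Real.abs_sin_le_one]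
  simp_rw [gauss_sin]
  have e : ∀ t : ℝ, t * (Real.sin (m * (t / h)) * Real.exp (-((t / h) ^ 2) / 2))
    = h * ((t / h) * (Real.sin (m * (t / h)) * Real.exp (-((t / h) ^ 2) / 2))) := fun t => by
      field_simp
  simp_rw [e]
  rw [intervalIntegral.integral_const_mul, intervalIntegral.integral_comp_div
    (fun s => s * (Real.sin (m * s) * Real.exp (-(s ^ 2) / 2))) hh.ne']
  simp; ring

lemma full_cos (m : ℝ) :
    ∫ s in Set.Ioi (0:ℝ), Real.cos (m * s) * Real.exp (-(s ^ 2) / 2) = Real.pi * phiR m := by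
  have h := gauss_cos m 0
  rw [gauss_int] at h
  have e := integral_comp_abs (f := fun s => Real.cos (m * s) * Real.exp (-(s ^ 2) / 2))
  have e2 : ∀ x : ℝ, Real.cos (m * |x|) * Real.exp (-(|x| ^ 2) / 2)
      = Real.sqrt (2 * Real.pi) * (phiR x * Real.cos (m * x + 0)) := fun x => by
    have : Real.cos (m * |x|) = Real.cos (m * x) := by
      rcases abs_choice x with h | h <;> rw [h]
      rw [mul_neg, Real.cos_neg]
    rw [this, sq_abs, add_zero, phiR]
    have : Real.sqrt (2 * Real.pi) ≠ 0 := by positivity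
    field_simp
  simp_rw [e2] at e
  rw [integral_const_mul, h, Real.cos_zero, one_mul] at e
  have hs : Real.sqrt (2 * Real.pi) ≠ 0 := by positivity
  have hq : Real.sqrt (2 * Real.pi) ^ 2 = 2 * Real.pi := Real.sq_sqrt (by positivity)
  have : Real.pi * phiR m = Real.sqrt (2 * Real.pi) * Real.exp (-(m ^ 2) / 2) / 2 := by
    unfold phiR
    have hi : (Real.sqrt (2 * Real.pi))⁻¹ * (2 * Real.pi) = Real.sqrt (2 * Real.pi) := by
      rw [inv_mul_eq_iff_eq_mul₀ hs, ← sq, hq]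
    linear_combination (Real.exp (-(m ^ 2) / 2) / 2) * hi
  rw [this, e]; ring

lemma cosexp_int (m : ℝ) : Integrable (fun s => Real.cos (m * s) * Real.exp (-(s ^ 2) / 2)) :=
  exp_integrable.bdd_mul (c := 1) (by fun_prop : Continuous _).aestronglyMeasurable
    (Filter.Eventually.of_forall fun _ => Real.abs_cos_le_one _)

lemma sinexp_int (m : ℝ) :
    Integrable (fun s => s * (Real.sin (m * s) * Real.exp (-(s ^ 2) / 2))) := by
  have : Integrable (fun s => Real.sin (m * s) * (s * Real.exp (-(s ^ 2) / 2))) :=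
   xexp_integrable.bdd_mul (c := 1) (by fun_prop : Continuous _).aestronglyMeasurable
    (Filter.Eventually.of_forall fun _ => Real.abs_sin_le_one _)
  convert this using 2
  ring

lemma exp_tendsto : Filter.Tendsto (fun s : ℝ => Real.exp (-(s ^ 2) / 2)) Filter.atTop (nhds 0) := by
  refine Real.tendsto_exp_atBot.comp ?_
  have h : Filter.Tendsto (fun s : ℝ => s ^ 2 / 2) Filter.atTop Filter.atTop :=
    (Filter.tendsto_pow_atTop two_ne_zero).atTop_div_const two_pos
  have := Filter.tendsto_neg_atTop_atBot.comp h
  refine this.congr fun x => ?_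
  simp; ring

lemma exp_hasDeriv (x : ℝ) : HasDerivAt (fun s : ℝ => Real.exp (-(s ^ 2) / 2))
    (-(x * Real.exp (-(x ^ 2) / 2))) x := by
  have := ((hasDerivAt_pow 2 x).neg.div_const 2).exp
  exact this.congr_deriv (by simp; ring)

lemma full_sin (m : ℝ) :
    ∫ s in Set.Ioi (0:ℝ), s * (Real.sin (m * s) * Real.exp (-(s ^ 2) / 2))
      = Real.pi * (m * phiR m) := by
  have hd : ∀ x ∈ Set.Ici (0:ℝ),
      HasDerivAt (fun s => Real.sin (m * s) * Real.exp (-(s ^ 2) / 2))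
      (m * (Real.cos (m * x) * Real.exp (-(x ^ 2) / 2))
        - x * (Real.sin (m * x) * Real.exp (-(x ^ 2) / 2))) x := fun x _ => by
    have := (((hasDerivAt_id x).const_mul m).sin).mul (exp_hasDeriv x)
    exact this.congr_deriv (by simp; ring)
  have h := integral_Ioi_of_hasDerivAt_of_tendsto' hd
    (((cosexp_int m).const_mul m).sub (sinexp_int m)).integrableOn (m := 0) ?_
  · rw [integral_sub ((cosexp_int m).const_mul m).integrableOn (sinexp_int m).integrableOn,
      integral_const_mul, full_cos] at h
    simp at h
    linarith
  · refine squeeze_zero_norm (fun x => ?_) exp_tendsto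
    rw [norm_mul, Real.norm_eq_abs, Real.norm_eq_abs, Real.abs_exp]
    exact mul_le_of_le_one_left (Real.exp_pos _).le (Real.abs_sin_le_one _)

lemma tail_xexp (a : ℝ) :
    ∫ s in Set.Ioi a, s * Real.exp (-(s ^ 2) / 2) = Real.exp (-(a ^ 2) / 2) := by
  have h := integral_Ioi_of_hasDerivAt_of_tendsto' (a := a) (fun x _ => (exp_hasDeriv x).neg)
    (by simpa using xexp_integrable.integrableOn) (m := 0) (by
      have := exp_tendsto.neg
      rw [neg_zero] at this
      exact this)
  simpa using h

lemma tail_sin (m a : ℝ) (ha : 0 < a) :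
    |Real.pi * (m * phiR m) - ∫ s in (0:ℝ)..a, s * (Real.sin (m * s) * Real.exp (-(s ^ 2) / 2))|
      ≤ Real.exp (-(a ^ 2) / 2) := by
  rw [← full_sin, ← intervalIntegral.integral_Ioi_sub_Ioi (sinexp_int m).integrableOn ha.le,
    sub_sub_cancel, ← tail_xexp, ← Real.norm_eq_abs]
  refine norm_integral_le_of_norm_le xexp_integrable.integrableOn ?_
  refine ae_restrict_of_forall_mem measurableSet_Ioi fun x hx => ?_
  have hx0 : 0 < x := ha.trans hx
  rw [norm_mul, norm_mul, Real.norm_eq_abs, Real.norm_eq_abs, Real.norm_eq_abs, Real.abs_exp,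
    abs_of_pos hx0]
  gcongr
  exact mul_le_of_le_one_left (Real.exp_pos _).le (Real.abs_sin_le_one _)

lemma tail_cos (m a : ℝ) (ha : 0 < a) :
    |Real.pi * phiR m - ∫ s in (0:ℝ)..a, (Real.cos (m * s) * Real.exp (-(s ^ 2) / 2))|
      ≤ a⁻¹ * Real.exp (-(a ^ 2) / 2) := by
  rw [← full_cos, ← intervalIntegral.integral_Ioi_sub_Ioi (cosexp_int m).integrableOn ha.le,
    sub_sub_cancel, ← tail_xexp, ← Real.norm_eq_abs, ← integral_const_mul]
  refine norm_integral_le_of_norm_le (xexp_integrable.const_mul _).integrableOn ?_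
  refine ae_restrict_of_forall_mem measurableSet_Ioi fun x hx => ?_
  have hx0 : a < x := hx
  rw [norm_mul, Real.norm_eq_abs, Real.norm_eq_abs, Real.abs_exp, ← mul_assoc]
  gcongr
  refine (Real.abs_cos_le_one _).trans ?_
  rw [inv_mul_eq_div, one_le_div ha]
  exact hx0.le

lemma bias0 (m h : ℝ) (hh : 0 < h) :
    |phiR m - h⁻¹ * ∫ x, sincR ((x + m) / h) ∂(gaussianReal 0 1)|
      ≤ h * Real.exp (-1 / (2 * h ^ 2)) := by
  rw [E_sinc m h hh]
  have t := tail_cos m (1 / h) (by positivity)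
  have e : Real.exp (-((1 / h) ^ 2) / 2) = Real.exp (-1 / (2 * h ^ 2)) := by
    congr 1; field_simp
  rw [e] at t
  have e2 : ∀ J, phiR m - h⁻¹ * (h * Real.pi⁻¹ * J) = Real.pi⁻¹ * (Real.pi * phiR m - J) := by
    intro J; field_simp
  rw [e2, abs_mul, abs_of_pos (by positivity : 0 < Real.pi⁻¹)]
  have hp : Real.pi⁻¹ ≤ 1 := inv_le_one_of_one_le₀ (by linarith [Real.pi_gt_three])
  refine (mul_le_of_le_one_left (abs_nonneg _) hp).trans (t.trans (by simp))

lemma bias1 (m h : ℝ) (hh : 0 < h) :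
    |-(m * phiR m) - (h ^ 2)⁻¹ * ∫ x, S1 ((x + m) / h) ∂(gaussianReal 0 1)|
      ≤ Real.exp (-1 / (2 * h ^ 2)) := by
  rw [E_S1 m h hh]
  have t := tail_sin m (1 / h) (by positivity)
  have e : Real.exp (-((1 / h) ^ 2) / 2) = Real.exp (-1 / (2 * h ^ 2)) := by
    congr 1; field_simp
  rw [e] at t
  have e2 : ∀ J, -(m * phiR m) - (h ^ 2)⁻¹ * -(h ^ 2 * Real.pi⁻¹ * J)
      = -(Real.pi⁻¹ * (Real.pi * (m * phiR m) - J)) := by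
    intro J; field_simp; ring
  rw [e2, abs_neg, abs_mul, abs_of_pos (by positivity : 0 < Real.pi⁻¹)]
  have hp : Real.pi⁻¹ ≤ 1 := inv_le_one_of_one_le₀ (by linarith [Real.pi_gt_three])
  exact (mul_le_of_le_one_left (abs_nonneg _) hp).trans t

lemma gauss_std (μ σ : ℝ) (F : ℝ → ℝ) (hF : Continuous F) :
    ∫ y, F y ∂(gaussianReal μ ((σ ^ 2).toNNReal))
      = ∫ x, F (σ * x + μ) ∂(gaussianReal 0 1) := by
  have e : gaussianReal μ ((σ ^ 2).toNNReal) = (gaussianReal 0 1).map (fun x => σ * x + μ) := by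
    have h1 := gaussianReal_map_const_mul (μ := 0) (v := 1) σ
    have h2 := gaussianReal_map_add_const (μ := σ * 0) (v := .mk (σ ^ 2) (sq_nonneg _) * 1) μ
    rw [← h1, Measure.map_map (by fun_prop) (by fun_prop)] at h2
    rw [mul_zero, zero_add, mul_one] at h2
    have e3 : (σ ^ 2).toNNReal = .mk (σ ^ 2) (sq_nonneg _) := by
      ext; simp [sq_nonneg]
    rw [e3, ← h2]; rfl
  rw [e, integral_map (by fun_prop) hF.aestronglyMeasurable]

/-- Gaussian expectation via Stein. -/
lemma E_stein (f f' : ℝ → ℝ) (hf : ∀ x, HasDerivAt f (f' x) x) (hc : Continuous f')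
    (hb : ∀ x, |f x| ≤ 1) (hb' : ∀ x, |f' x| ≤ 1) (μ K σ h d : ℝ) (hσ : 0 < σ) (hh : 0 < h) :
    Integrable (fun y => (y - K) * f ((y - d) / (σ * h)) - (σ / h) * f' ((y - d) / (σ * h)))
      (gaussianReal μ ((σ ^ 2).toNNReal)) ∧
    ∫ y, ((y - K) * f ((y - d) / (σ * h)) - (σ / h) * f' ((y - d) / (σ * h)))
      ∂(gaussianReal μ ((σ ^ 2).toNNReal))
    = (μ - K) * ∫ x, f ((x + (μ - d) / σ) / h) ∂(gaussianReal 0 1) := by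
  have hfc : Continuous f := continuous_iff_continuousAt.2 fun u => (hf u).continuousAt
  constructor
  · refine Integrable.sub ?_ ?_
    · refine Integrable.mul_bdd (c := 1) ?_ (by fun_prop : Continuous _).aestronglyMeasurable
        (Filter.Eventually.of_forall fun _ => hb _)
      refine Integrable.sub ?_ (integrable_const _)
      exact (memLp_id_gaussianReal 1).integrable (by simp)
    · refine Integrable.const_mul ?_ _
      exact Integrable.of_bound (by fun_prop : Continuous _).aestronglyMeasurable 1
        (Filter.Eventually.of_forall fun _ => hb' _)
  · rw [gauss_std _ _ _ (by fun_prop)]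
    set m := (μ - d) / σ with hm
    have e : ∀ x, (σ * x + μ - d) / (σ * h) = (x + m) / h := fun x => by
      rw [hm]; field_simp; ring
    simp_rw [e]
    have hif : Integrable (fun x => f ((x + m) / h)) (gaussianReal 0 1) :=
      Integrable.of_bound (by fun_prop : Continuous _).aestronglyMeasurable 1
        (Filter.Eventually.of_forall fun _ => hb _)
    have hif' : Integrable (fun x => f' ((x + m) / h)) (gaussianReal 0 1) :=
      Integrable.of_bound (by fun_prop : Continuous _).aestronglyMeasurable 1
        (Filter.Eventually.of_forall fun _ => hb' _)
    have hix : Integrable (fun x => x * f ((x + m) / h)) (gaussianReal 0 1) :=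
      Integrable.mul_bdd (c := 1) ((memLp_id_gaussianReal 1).integrable (by simp))
        (by fun_prop : Continuous _).aestronglyMeasurable
        (Filter.Eventually.of_forall fun _ => hb _)
    have st := stein (fun x => f ((x + m) / h)) (fun x => f' ((x + m) / h) / h)
      (fun x => by
        have := (hf ((x + m) / h)).comp x (((hasDerivAt_id x).add_const m).div_const h)
        exact this.congr_deriv (by simp; ring)) (by fun_prop) (max 1 (1 / h))
      (fun x => (hb _).trans (le_max_left _ _))
      (fun x => by
        rw [abs_div, abs_of_pos hh]
        refine le_trans ?_ (le_max_right _ _)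
        gcongr
        exact hb' _)
    rw [integral_div] at st
    have e2 : ∀ x, (σ * x + μ - K) * f ((x + m) / h) - σ / h * f' ((x + m) / h)
      = (σ * (x * f ((x + m) / h)) + (μ - K) * f ((x + m) / h)) - σ / h * f' ((x + m) / h) :=
        fun x => by ring
    simp_rw [e2]
    have ha : Integrable (fun x => σ * (x * f ((x + m) / h)) + (μ - K) * f ((x + m) / h))
        (gaussianReal 0 1) := (hix.const_mul _).add (hif.const_mul _)
    rw [integral_sub ha (hif'.const_mul _),
      integral_add (hix.const_mul _) (hif.const_mul _), integral_const_mul, integral_const_mul,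
      integral_const_mul, st]
    ring

lemma W_one (μ K σ : ℝ) (δ : ℝ → ℝ) (hδ : Differentiable ℝ δ) (b : ℝ) :
    HasDerivAt (fun b => (μ - K) * PhiR ((μ - δ b) / σ))
      (-(μ - K) / σ * (phiR ((μ - δ b) / σ) * deriv δ b)) b := by
  have := ((PhiR_hasDeriv ((μ - δ b) / σ)).comp b
    (((hδ b).hasDerivAt.const_sub μ).div_const σ)).const_mul (μ - K)
  exact this.congr_deriv (by ring)

lemma W_two (μ K σ : ℝ) (δ : ℝ → ℝ) (hδ : Differentiable ℝ δ) (hδ' : Differentiable ℝ (deriv δ))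
    (b : ℝ) :
    HasDerivAt (fun b => -(μ - K) / σ * (phiR ((μ - δ b) / σ) * deriv δ b))
      ((μ - K) / σ ^ 2 * (deriv δ b) ^ 2 * (-((μ - δ b) / σ * phiR ((μ - δ b) / σ)))
        - (μ - K) / σ * deriv (deriv δ) b * phiR ((μ - δ b) / σ)) b := by
  have := (((phiR_hasDeriv ((μ - δ b) / σ)).comp b
    (((hδ b).hasDerivAt.const_sub μ).div_const σ)).mul (hδ' b).hasDerivAt).const_mul (-(μ - K) / σ)
  exact this.congr_deriv (by simp only [Function.comp]; ring)

lemma A_aux (f f' : ℝ → ℝ) (hf : ∀ x, HasDerivAt f (f' x) x) (y σ h : ℝ)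
    (δ : ℝ → ℝ) (hδ : Differentiable ℝ δ) (b : ℝ) :
    HasDerivAt (fun b => f ((y - δ b) / (σ * h)))
      (-(deriv δ b / (σ * h)) * f' ((y - δ b) / (σ * h))) b := by
  have := (hf ((y - δ b) / (σ * h))).comp b
    (((hδ b).hasDerivAt.const_sub y).div_const (σ * h))
  exact this.congr_deriv (by ring)

lemma A_one (K σ h y : ℝ) (δ : ℝ → ℝ) (hδ : Differentiable ℝ δ) (b : ℝ) :
    HasDerivAt (assureSummand K σ h δ y)
      (-(deriv δ b / (σ * h)) * ((y - K) * sincR ((y - δ b) / (σ * h))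
        - (σ / h) * S1 ((y - δ b) / (σ * h)))) b := by
  have := ((A_aux _ _ CsincR_hasDeriv y σ h δ hδ b).const_mul (y - K)).sub
    ((A_aux _ _ sincR_hasDeriv y σ h δ hδ b).const_mul (σ / h))
  exact this.congr_deriv (by ring)

lemma A_two (K σ h y : ℝ) (δ : ℝ → ℝ) (hδ : Differentiable ℝ δ)
    (hδ' : Differentiable ℝ (deriv δ)) (b : ℝ) :
    HasDerivAt (fun b => -(deriv δ b / (σ * h)) * ((y - K) * sincR ((y - δ b) / (σ * h))
        - (σ / h) * S1 ((y - δ b) / (σ * h))))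
      (-(deriv (deriv δ) b / (σ * h)) * ((y - K) * sincR ((y - δ b) / (σ * h))
        - (σ / h) * S1 ((y - δ b) / (σ * h)))
       + (deriv δ b / (σ * h)) ^ 2 * ((y - K) * S1 ((y - δ b) / (σ * h))
        - (σ / h) * S2 ((y - δ b) / (σ * h)))) b := by
  have := ((hδ' b).hasDerivAt.div_const (σ * h)).neg.mul
    (((A_aux _ _ sincR_hasDeriv y σ h δ hδ b).const_mul (y - K)).sub
    ((A_aux _ _ S1_hasDeriv y σ h δ hδ b).const_mul (σ / h)))
  exact this.congr_deriv (by simp only [Pi.neg_apply, Pi.sub_apply]; ring)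

lemma unit_one (μ K σ h : ℝ) (hσ : 0 < σ) (hh : 0 < h) (δ : ℝ → ℝ) (hδ : Differentiable ℝ δ)
    (b : ℝ) :
    |-(μ - K) / σ * (phiR ((μ - δ b) / σ) * deriv δ b)
      - ∫ y, deriv (assureSummand K σ h δ y) b ∂(gaussianReal μ ((σ ^ 2).toNNReal))|
    ≤ (|μ - K| / σ) * |deriv δ b| * (h * Real.exp (-1 / (2 * h ^ 2))) := by
  simp_rw [(A_one K σ h _ δ hδ b).deriv]
  rw [integral_const_mul, (E_stein _ _ sincR_hasDeriv S1_cont sincR_bound S1_bound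
    μ K σ h (δ b) hσ hh).2]
  have t := bias0 ((μ - δ b) / σ) h hh
  set I := ∫ x, sincR ((x + (μ - δ b) / σ) / h) ∂(gaussianReal 0 1)
  have e : -(μ - K) / σ * (phiR ((μ - δ b) / σ) * deriv δ b)
      - -(deriv δ b / (σ * h)) * ((μ - K) * I)
      = -((μ - K) / σ * deriv δ b * (phiR ((μ - δ b) / σ) - h⁻¹ * I)) := by
    field_simp; ring
  rw [e, abs_neg, abs_mul, abs_mul, abs_div, abs_of_pos hσ]
  gcongr

lemma unit_two (μ K σ h : ℝ) (hσ : 0 < σ) (hh : 0 < h) (δ : ℝ → ℝ) (hδ : Differentiable ℝ δ)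
    (hδ' : Differentiable ℝ (deriv δ)) (b : ℝ) :
    |((μ - K) / σ ^ 2 * (deriv δ b) ^ 2 * (-((μ - δ b) / σ * phiR ((μ - δ b) / σ)))
        - (μ - K) / σ * deriv (deriv δ) b * phiR ((μ - δ b) / σ))
      - ∫ y, deriv (deriv (assureSummand K σ h δ y)) b ∂(gaussianReal μ ((σ ^ 2).toNNReal))|
    ≤ (h * ((|μ - K| / σ) * |deriv (deriv δ) b|) + (|μ - K| / σ ^ 2) * (deriv δ b) ^ 2)
      * Real.exp (-1 / (2 * h ^ 2)) := by
  have ed : ∀ y, deriv (assureSummand K σ h δ y) = _ :=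
    fun y => funext fun b => (A_one K σ h y δ hδ b).deriv
  simp_rw [ed, (A_two K σ h _ δ hδ hδ' b).deriv]
  have s0 := E_stein _ _ sincR_hasDeriv S1_cont sincR_bound S1_bound μ K σ h (δ b) hσ hh
  have s1 := E_stein _ _ S1_hasDeriv S2_cont S1_bound S2_bound μ K σ h (δ b) hσ hh
  rw [integral_add (s0.1.const_mul _) (s1.1.const_mul _), integral_const_mul, integral_const_mul,
    s0.2, s1.2]
  have t0 := bias0 ((μ - δ b) / σ) h hh
  have t1 := bias1 ((μ - δ b) / σ) h hh
  set I := ∫ x, sincR ((x + (μ - δ b) / σ) / h) ∂(gaussianReal 0 1)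
  set J := ∫ x, S1 ((x + (μ - δ b) / σ) / h) ∂(gaussianReal 0 1)
  set m := (μ - δ b) / σ
  have e : ((μ - K) / σ ^ 2 * (deriv δ b) ^ 2 * (-(m * phiR m))
        - (μ - K) / σ * deriv (deriv δ) b * phiR m)
      - (-(deriv (deriv δ) b / (σ * h)) * ((μ - K) * I)
        + (deriv δ b / (σ * h)) ^ 2 * ((μ - K) * J))
      = (μ - K) / σ ^ 2 * (deriv δ b) ^ 2 * (-(m * phiR m) - (h ^ 2)⁻¹ * J)
        - (μ - K) / σ * deriv (deriv δ) b * (phiR m - h⁻¹ * I) := by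
    field_simp; ring
  rw [e]
  refine (abs_sub _ _).trans ?_
  have h1 : |(μ - K) / σ ^ 2 * (deriv δ b) ^ 2 * (-(m * phiR m) - (h ^ 2)⁻¹ * J)|
      ≤ |μ - K| / σ ^ 2 * (deriv δ b) ^ 2 * Real.exp (-1 / (2 * h ^ 2)) := by
    rw [abs_mul, abs_mul, abs_div, abs_of_pos (pow_pos hσ 2), abs_of_nonneg (sq_nonneg (deriv δ b))]
    gcongr
  have h2 : |(μ - K) / σ * deriv (deriv δ) b * (phiR m - h⁻¹ * I)|
      ≤ |μ - K| / σ * |deriv (deriv δ) b| * (h * Real.exp (-1 / (2 * h ^ 2))) := by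
    rw [abs_mul, abs_mul, abs_div, abs_of_pos hσ]
    gcongr
  linarith

lemma avg_bound (n : ℕ) (A B C : Fin n → ℝ) (hb : ∀ i, |A i - B i| ≤ C i) :
    |(1 / (n:ℝ)) * ∑ i, A i - (1 / (n:ℝ)) * ∑ i, B i| ≤ (1 / (n:ℝ)) * ∑ i, C i := by
  rw [← mul_sub, ← Finset.sum_sub_distrib, abs_mul, abs_of_nonneg (by positivity : 0 ≤ 1 / (n:ℝ))]
  gcongr
  exact (Finset.abs_sum_le_sum_abs _ _).trans (Finset.sum_le_sum fun i _ => hb i)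

/-- uniform bounds on the bias of the first and second `β`-derivatives
of the ASSURE estimator for the corresponding derivatives of the welfare. -/
theorem assure_derivative_bias :
    ∃ c : ℝ, 0 < c ∧
      ∀ (n : ℕ), 1 ≤ n → ∀ (h : ℝ), 0 < h →
      ∀ (μ K σ : Fin n → ℝ), (∀ i, 0 < σ i) →
      ∀ (δ : ℝ → Fin n → ℝ), (∀ i, ContDiff ℝ 2 (fun β => δ β i)) →
      ∀ β : ℝ,
        |deriv (fun b => (1 / (n:ℝ)) * ∑ i, (μ i - K i) * PhiR ((μ i - δ b i) / σ i)) β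
            - (1 / (n:ℝ)) * ∑ i, ∫ y,
                deriv (assureSummand (K i) (σ i) h (fun b => δ b i) y) β
                ∂(gaussianReal (μ i) ((σ i ^ 2).toNNReal))|
          ≤ c * ((1 / (n:ℝ)) * ∑ i, (|μ i - K i| / σ i) * |deriv (fun b => δ b i) β|)
              * h * Real.exp (-1 / (2 * h ^ 2)) ∧
        |deriv (deriv (fun b =>
              (1 / (n:ℝ)) * ∑ i, (μ i - K i) * PhiR ((μ i - δ b i) / σ i))) β
            - (1 / (n:ℝ)) * ∑ i, ∫ y,
                deriv (deriv (assureSummand (K i) (σ i) h (fun b => δ b i) y)) β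
                ∂(gaussianReal (μ i) ((σ i ^ 2).toNNReal))|
          ≤ c * (h * ((1 / (n:ℝ)) * ∑ i, (|μ i - K i| / σ i)
                  * |deriv (deriv (fun b => δ b i)) β|)
              + (1 / (n:ℝ)) * ∑ i, (|μ i - K i| / σ i ^ 2)
                  * (deriv (fun b => δ b i) β) ^ 2)
              * Real.exp (-1 / (2 * h ^ 2)) := by
  refine ⟨1, one_pos, ?_⟩
  intro n _ h hh μ K σ hσ δ hδ β
  have hd : ∀ i, Differentiable ℝ (fun b => δ b i) := fun i => (hδ i).differentiable two_ne_zero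
  have hd' : ∀ i, Differentiable ℝ (deriv (fun b => δ b i)) := fun i =>
    (hδ i).differentiable_deriv_two
  have d1 : deriv (fun b => (1 / (n:ℝ)) * ∑ i, (μ i - K i) * PhiR ((μ i - δ b i) / σ i)) =
      fun b => (1 / (n:ℝ)) * ∑ i, (-(μ i - K i) / σ i *
        (phiR ((μ i - δ b i) / σ i) * deriv (fun b => δ b i) b)) := by
    funext b
    exact ((HasDerivAt.fun_sum fun i _ =>
      W_one (μ i) (K i) (σ i) (fun b => δ b i) (hd i) b).const_mul _).deriv
  have d2 := ((HasDerivAt.fun_sum (u := Finset.univ) fun i _ =>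
      W_two (μ i) (K i) (σ i) (fun b => δ b i) (hd i) (hd' i) β).const_mul (1 / (n:ℝ))).deriv
  rw [d1, d2]
  constructor
  · refine (avg_bound n _ _ _ fun i =>
      unit_one (μ i) (K i) (σ i) h (hσ i) hh (fun b => δ b i) (hd i) β).trans (le_of_eq ?_)
    rw [← Finset.sum_mul]; ring
  · refine (avg_bound n _ _ _ fun i =>
      unit_two (μ i) (K i) (σ i) h (hσ i) hh (fun b => δ b i) (hd i) (hd' i) β).trans (le_of_eq ?_)
    rw [← Finset.sum_mul, Finset.sum_add_distrib, ← Finset.mul_sum]; ring
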